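/- arXiv:2412.20841 — 2 statements merged into one kernel-verified Lean document; each statement's English description precedes it below -/
import Mathlib

section
/- Let (X,d) be a compact, geodesic, non-branching metric space with diameter D > 0, and let μ be a finite Borel measure on X with full support (every nonempty open subset of X has positive measure). Assume (i) μ satisfies ball-intersection homogeneity, and (ii) every metric sphere is μ-null: μ({y ∈ X : d(x,y) = r}) = 0 for every x ∈ X and r > 0. Then every geodesic γ : [0,l] → X with 0 < l < D extends to a geodesic of length D, and this extension is unique: there is exactly one geodesic γ̃ : [0,D] → X with γ̃(s) = γ(s) for all s ∈ [0,l]. -/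
open MeasureTheory

/-- A unit-speed geodesic of length `l`: `dist (γ s) (γ t) = |s − t|` for `s, t ∈ [0, l]`. -/
def IsGeodesicOn {X : Type*} [MetricSpace X] (γ : ℝ → X) (l : ℝ) : Prop :=
  ∀ s ∈ Set.Icc (0 : ℝ) l, ∀ t ∈ Set.Icc (0 : ℝ) l, dist (γ s) (γ t) = |s - t|

/-- A geodesic space: any two points are joined by a unit-speed geodesic. -/
def IsGeodesicSpace (X : Type*) [MetricSpace X] : Prop :=
  ∀ x y : X, ∃ γ : ℝ → X, IsGeodesicOn γ (dist x y) ∧ γ 0 = x ∧ γ (dist x y) = y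

/-- Non-branching: two geodesics of length `L` agreeing on an initial segment `[0, ε]`,
`0 < ε ≤ L`, agree on all of `[0, L]`. -/
def NonBranching (X : Type*) [MetricSpace X] : Prop :=
  ∀ (L ε : ℝ), 0 < ε → ε ≤ L → ∀ γ₁ γ₂ : ℝ → X, IsGeodesicOn γ₁ L → IsGeodesicOn γ₂ L →
    (∀ s ∈ Set.Icc (0 : ℝ) ε, γ₁ s = γ₂ s) → ∀ s ∈ Set.Icc (0 : ℝ) L, γ₁ s = γ₂ s

theorem exists_dist_eq_diam {X : Type*} [MetricSpace X] [CompactSpace X] [Nonempty X] :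
    ∃ p q : X, dist p q = Metric.diam (Set.univ : Set X) := by
  obtain ⟨⟨p, q⟩, -, hpq⟩ := (isCompact_univ (X := X × X)).exists_isMaxOn Set.univ_nonempty
    (continuous_dist (α := X)).continuousOn
  refine ⟨p, q, le_antisymm ?_ ?_⟩
  · exact Metric.dist_le_diam_of_mem isCompact_univ.isBounded (Set.mem_univ p) (Set.mem_univ q)
  · exact Metric.diam_le_of_forall_dist_le dist_nonneg fun x _ y _ ↦ hpq (Set.mem_univ (x, y))

/-- Under ball-intersection homogeneity, the measure of a difference of two balls depends only on
the radii and the distance of the centers. -/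
theorem measure_ball_diff_ball_eq {X : Type*} [MetricSpace X]
    [MeasurableSpace X] [BorelSpace X] {μ : Measure X} [IsFiniteMeasure μ]
    {v : ℝ → ℝ → ℝ → ENNReal} (hv : ∀ x y : X, ∀ r s : ℝ, 0 < r → 0 < s →
      μ (Metric.ball x r ∩ Metric.ball y s) = v r s (dist x y))
    {x y x' y' : X} (h : dist x y = dist x' y') {r s : ℝ} (hr : 0 < r) (hs : 0 < s) :
    μ (Metric.ball x r \ Metric.ball y s) = μ (Metric.ball x' r \ Metric.ball y' s) := by
  have hball : μ (Metric.ball x r) = μ (Metric.ball x' r) := by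
    have h₁ := hv x x r r hr hr
    have h₂ := hv x' x' r r hr hr
    rw [Set.inter_self, dist_self] at h₁ h₂
    rw [h₁, h₂]
  have hdiff (a b : X) : μ (Metric.ball a r \ Metric.ball b s) =
      μ (Metric.ball a r) - μ (Metric.ball a r ∩ Metric.ball b s) := by
    rw [← Set.sdiff_self_inter]
    exact measure_sdiff Set.inter_subset_left
      (measurableSet_ball.inter measurableSet_ball).nullMeasurableSet (measure_ne_top μ _)
  rw [hdiff, hdiff, hball, hv x y r s hr hs, hv x' y' r s hr hs, h]

/-- If balls about `y` of radius slightly more than `t` are never contained in balls about `x` of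
radius slightly less than `R`, then some point at distance at most `t` from `y` has distance at
least `R` from `x`. -/
theorem exists_dist_le_and_le_dist {X : Type*} [MetricSpace X] [CompactSpace X] {x y : X}
    {t R : ℝ} (hR : 0 < R) (h : ∀ ε, 0 < ε → ε < R →
      (Metric.ball y (t + ε) \ Metric.ball x (R - ε)).Nonempty) :
    ∃ z : X, dist z y ≤ t ∧ R ≤ dist z x := by
  have hcont : Continuous fun z : X ↦ max (dist z y - t) (R - dist z x) := by fun_prop
  obtain ⟨z, -, hz⟩ := isCompact_univ.exists_isMinOn ⟨x, Set.mem_univ x⟩ hcont.continuousOn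
  have hnonpos : max (dist z y - t) (R - dist z x) ≤ 0 := by
    by_contra! hpos
    set m := max (dist z y - t) (R - dist z x) with hm
    obtain ⟨w, hw₁, hw₂⟩ := h (min (m / 2) (R / 2)) (by positivity)
      ((min_le_right _ _).trans_lt (by linarith))
    rw [Metric.mem_ball] at hw₁ hw₂
    have hmw : m ≤ max (dist w y - t) (R - dist w x) := hz (Set.mem_univ w)
    have hle := min_le_left (m / 2) (R / 2)
    have : max (dist w y - t) (R - dist w x) ≤ m / 2 := max_le (by linarith) (by linarith)
    linarith
  obtain ⟨h₁, h₂⟩ := max_le_iff.1 hnonpos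
  exact ⟨z, by linarith, by linarith⟩

/-- Two consecutive geodesics whose lengths add up to the distance of the outer endpoints
concatenate to a geodesic. -/
theorem IsGeodesicOn.concat {X : Type*} [MetricSpace X] {γ η : ℝ → X} {l t : ℝ} (hl : 0 ≤ l)
    (ht : 0 ≤ t) (hγ : IsGeodesicOn γ l) (hη : IsGeodesicOn η t) (hjoin : η 0 = γ l)
    (hdist : l + t ≤ dist (γ 0) (η t)) :
    IsGeodesicOn (fun s ↦ if s ≤ l then γ s else η (s - l)) (l + t) := by
  have key (s u : ℝ) (hs₀ : 0 ≤ s) (hs : s ≤ l) (hu : l < u) (hut : u ≤ l + t) :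
      dist (γ s) (η (u - l)) = |s - u| := by
    have h₁ := hγ 0 ⟨le_rfl, hl⟩ s ⟨hs₀, hs⟩
    have h₂ := hγ s ⟨hs₀, hs⟩ l ⟨hl, le_rfl⟩
    have h₃ := hη 0 ⟨le_rfl, ht⟩ (u - l) ⟨by linarith, by linarith⟩
    have h₄ := hη (u - l) ⟨by linarith, by linarith⟩ t ⟨ht, le_rfl⟩
    rw [abs_of_nonpos (by linarith)] at h₁ h₂ h₃ h₄ ⊢
    rw [hjoin] at h₃
    have h₅ := dist_triangle4 (γ 0) (γ s) (η (u - l)) (η t)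
    have h₆ := dist_triangle (γ s) (γ l) (η (u - l))
    linarith
  rintro s ⟨hs₀, hs⟩ u ⟨hu₀, hu⟩
  dsimp only
  split_ifs with hsl hul hul
  · exact hγ s ⟨hs₀, hsl⟩ u ⟨hu₀, hul⟩
  · exact key s u hs₀ hsl (not_le.1 hul) hu
  · rw [dist_comm, abs_sub_comm]
    exact key u s hu₀ hul (not_le.1 hsl) hs
  · rw [hη (s - l) ⟨by linarith, by linarith⟩ (u - l) ⟨by linarith, by linarith⟩,
      sub_sub_sub_cancel_right]

/-- Remark 4.14: in a compact, geodesic, non-branching space with a fully supported finite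
Borel measure satisfying ball-intersection homogeneity and giving no mass to spheres, every
geodesic of length `l ∈ (0, D)` extends *uniquely* to a geodesic of length `D = diam X`. -/
theorem stmt_6 {X : Type*} [MetricSpace X] [CompactSpace X]
    [MeasurableSpace X] [BorelSpace X]
    (hgeo : IsGeodesicSpace X) (hnb : NonBranching X)
    (D : ℝ) (hD : 0 < D) (hdiam : Metric.diam (Set.univ : Set X) = D)
    (μ : Measure X) [IsFiniteMeasure μ]
    (hsupp : ∀ U : Set X, IsOpen U → U.Nonempty → 0 < μ U)
    (hhom : ∃ v : ℝ → ℝ → ℝ → ENNReal, ∀ x y : X, ∀ r s : ℝ, 0 < r → 0 < s →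
      μ (Metric.ball x r ∩ Metric.ball y s) = v r s (dist x y))
    (hsph : ∀ x : X, ∀ r : ℝ, 0 < r → μ (Metric.sphere x r) = 0)
    (γ : ℝ → X) (l : ℝ) (hl : 0 < l) (hlD : l < D) (hγ : IsGeodesicOn γ l) :
    ∃ γ' : ℝ → X, (IsGeodesicOn γ' D ∧ ∀ s ∈ Set.Icc (0 : ℝ) l, γ' s = γ s) ∧
      ∀ γ'' : ℝ → X, (IsGeodesicOn γ'' D ∧ ∀ s ∈ Set.Icc (0 : ℝ) l, γ'' s = γ s) →
        ∀ s ∈ Set.Icc (0 : ℝ) D, γ'' s = γ' s := by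
  have : Nonempty X := ⟨γ 0⟩
  obtain ⟨v, hv⟩ := hhom
  obtain ⟨p, q, hpq⟩ := exists_dist_eq_diam (X := X)
  rw [hdiam] at hpq
  obtain ⟨σ, hσ, -, -⟩ := hgeo p q
  rw [hpq] at hσ
  have hσ₀ : dist (σ l) (σ 0) = dist (γ l) (γ 0) := by
    rw [hσ l ⟨hl.le, hlD.le⟩ 0 ⟨le_rfl, hD.le⟩, hγ l ⟨hl.le, le_rfl⟩ 0 ⟨le_rfl, hl.le⟩]
  have hσ₁ : dist (σ D) (σ l) = D - l := by
    rw [hσ D ⟨hD.le, le_rfl⟩ l ⟨hl.le, hlD.le⟩, abs_of_pos (by linarith)]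
  have hσ₂ : dist (σ D) (σ 0) = D := by
    rw [hσ D ⟨hD.le, le_rfl⟩ 0 ⟨le_rfl, hD.le⟩, sub_zero, abs_of_pos hD]
  obtain ⟨z, hz₁, hz₂⟩ : ∃ z : X, dist z (γ l) ≤ D - l ∧ D ≤ dist z (γ 0) := by
    refine exists_dist_le_and_le_dist hD fun ε hε hεD ↦ nonempty_of_measure_ne_zero (μ := μ) ?_
    rw [← measure_ball_diff_ball_eq hv hσ₀ (by linarith) (by linarith)]
    refine ((hsupp _ Metric.isOpen_ball ⟨σ D, Metric.mem_ball_self hε⟩).trans_le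
      (measure_mono fun w hw ↦ ?_)).ne'
    rw [Metric.mem_ball] at hw
    rw [Set.mem_sdiff, Metric.mem_ball, Metric.mem_ball, not_lt]
    have h₁ := dist_triangle w (σ D) (σ l)
    have h₂ := dist_triangle_left (σ D) (σ 0) w
    constructor <;> linarith
  have hγl : dist (γ l) (γ 0) = l := by
    rw [hγ l ⟨hl.le, le_rfl⟩ 0 ⟨le_rfl, hl.le⟩, sub_zero, abs_of_pos hl]
  have hz : dist (γ l) z = D - l := by
    have := dist_triangle z (γ l) (γ 0)
    rw [dist_comm]
    linarith
  obtain ⟨η, hη, hη₀, hη₁⟩ := hgeo (γ l) z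
  rw [hz] at hη hη₁
  have hext := hγ.concat hl.le (by linarith) hη hη₀
    (by rw [hη₁, dist_comm]; linarith)
  rw [add_sub_cancel] at hext
  refine ⟨_, ⟨hext, fun s hs ↦ if_pos hs.2⟩, fun γ'' ⟨hγ'', heq⟩ ↦ ?_⟩
  exact hnb D l hl hlD.le γ'' _ hγ'' hext fun s hs ↦ (heq s hs).trans (if_pos hs.2).symm
end

section
/- Let (X,d) be a compact, geodesic, non-branching metric space with diameter D > 0, and fix x₀ ∈ X. Assume that for every y ∈ X with y ≠ x₀ there is exactly one geodesic from x₀ to y, and that every geodesic issuing from x₀ of length l ∈ (0,D) extends to a geodesic of length D issuing from x₀. Then for all 0 < r₁ < r₂ < D, the map F : {y : d(x₀,y) = r₂} → {y : d(x₀,y) = r₁} sending y to γ_{x₀,y}(r₁), where γ_{x₀,y} is the unique geodesic from x₀ to y, is well defined and is a homeomorphism between the two spheres (with their subspace topologies). -/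
/-- The concatenation of two geodesics whose lengths add up to the distance between the
endpoints is a geodesic. -/
theorem IsGeodesicOn.concat_s7 {X : Type*} [MetricSpace X] {γ₁ γ₂ : ℝ → X} {a b : ℝ}
    (ha : 0 ≤ a) (hb : 0 ≤ b) (h₁ : IsGeodesicOn γ₁ a) (h₂ : IsGeodesicOn γ₂ b)
    (hjoin : γ₁ a = γ₂ 0) (hdist : dist (γ₁ 0) (γ₂ b) = a + b) :
    IsGeodesicOn (fun s => if s ≤ a then γ₁ s else γ₂ (s - a)) (a + b) := by
  have key : ∀ s t : ℝ, 0 ≤ s → s ≤ a → a ≤ t → t ≤ a + b →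
      dist (γ₁ s) (γ₂ (t - a)) = t - s := by
    intro s t hs hsa hat htb
    have e₁ : dist (γ₁ 0) (γ₁ s) = s := by
      rw [h₁ 0 ⟨le_rfl, ha⟩ s ⟨hs, hsa⟩, zero_sub, abs_neg, abs_of_nonneg hs]
    have e₂ : dist (γ₁ s) (γ₁ a) = a - s := by
      rw [h₁ s ⟨hs, hsa⟩ a ⟨ha, le_rfl⟩, abs_sub_comm, abs_of_nonneg (by linarith)]
    have e₃ : dist (γ₁ a) (γ₂ (t - a)) = t - a := by
      rw [hjoin, h₂ 0 ⟨le_rfl, hb⟩ (t - a) ⟨by linarith, by linarith⟩, zero_sub, abs_neg,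
        abs_of_nonneg (by linarith)]
    have e₄ : dist (γ₂ (t - a)) (γ₂ b) = b - (t - a) := by
      rw [h₂ (t - a) ⟨by linarith, by linarith⟩ b ⟨hb, le_rfl⟩, abs_sub_comm,
        abs_of_nonneg (by linarith)]
    have t₁ := dist_triangle (γ₁ s) (γ₁ a) (γ₂ (t - a))
    have t₂ := dist_triangle4 (γ₁ 0) (γ₁ s) (γ₂ (t - a)) (γ₂ b)
    linarith
  rintro s ⟨hs, hsb⟩ t ⟨ht, htb⟩
  by_cases hsa : s ≤ a <;> by_cases hta : t ≤ a <;> simp only [hsa, hta, if_true, if_false]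
  · exact h₁ s ⟨hs, hsa⟩ t ⟨ht, hta⟩
  · rw [key s t hs hsa (by linarith) htb, abs_sub_comm, abs_of_nonneg (by linarith)]
  · rw [dist_comm, key t s ht hta (by linarith) hsb, abs_of_nonneg (by linarith)]
  · rw [h₂ (s - a) ⟨by linarith, by linarith⟩ (t - a) ⟨by linarith, by linarith⟩,
      sub_sub_sub_cancel_right]

theorem IsGeodesicOn.mono {X : Type*} [MetricSpace X] {γ : ℝ → X} {a b : ℝ}
    (h : IsGeodesicOn γ b) (hab : a ≤ b) : IsGeodesicOn γ a :=
  fun s hs t ht => h s ⟨hs.1, hs.2.trans hab⟩ t ⟨ht.1, ht.2.trans hab⟩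

theorem IsGeodesicOn.dist_zero {X : Type*} [MetricSpace X] {γ : ℝ → X} {l s : ℝ}
    (h : IsGeodesicOn γ l) (hs : 0 ≤ s) (hsl : s ≤ l) : dist (γ 0) (γ s) = s := by
  rw [h 0 ⟨le_rfl, hs.trans hsl⟩ s ⟨hs, hsl⟩, zero_sub, abs_neg, abs_of_nonneg hs]


/-- The sphere-projection map `y ↦ γ_{x₀,y}(r₁)` from `∂B_{r₂}(x₀)` to `∂B_{r₁}(x₀)` is
well defined and is a homeomorphism (proof of Corollary 4.15). Here `Γ y` is the unique
geodesic from `x₀` to `y`. -/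
theorem stmt_7 {X : Type*} [MetricSpace X] [CompactSpace X]
    (hgeo : IsGeodesicSpace X) (hnb : NonBranching X)
    (D : ℝ) (hD : 0 < D) (hdiam : Metric.diam (Set.univ : Set X) = D)
    (x₀ : X) (Γ : X → ℝ → X)
    (hΓ : ∀ y : X, y ≠ x₀ →
      IsGeodesicOn (Γ y) (dist x₀ y) ∧ Γ y 0 = x₀ ∧ Γ y (dist x₀ y) = y)
    (huniq : ∀ y : X, y ≠ x₀ → ∀ γ : ℝ → X,
      IsGeodesicOn γ (dist x₀ y) → γ 0 = x₀ → γ (dist x₀ y) = y →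
      ∀ s ∈ Set.Icc (0 : ℝ) (dist x₀ y), γ s = Γ y s)
    (hext : ∀ l : ℝ, 0 < l → l < D → ∀ γ : ℝ → X, IsGeodesicOn γ l → γ 0 = x₀ →
      ∃ γ' : ℝ → X, IsGeodesicOn γ' D ∧ ∀ s ∈ Set.Icc (0 : ℝ) l, γ' s = γ s)
    (r₁ r₂ : ℝ) (hr₁ : 0 < r₁) (hr₁₂ : r₁ < r₂) (hr₂ : r₂ < D) :
    (∀ y : X, dist x₀ y = r₂ → dist x₀ (Γ y r₁) = r₁) ∧
    ∃ H : (Metric.sphere x₀ r₂) ≃ₜ (Metric.sphere x₀ r₁),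
      ∀ y : Metric.sphere x₀ r₂, (H y : X) = Γ (y : X) r₁ := by
  have hr₂0 : 0 < r₂ := hr₁.trans hr₁₂
  have ne_base : ∀ {y : X} {r : ℝ}, 0 < r → dist x₀ y = r → y ≠ x₀ := by
    rintro y r hr hy rfl
    rw [dist_self] at hy
    exact hr.ne hy
  have geo : ∀ {y : X} {r : ℝ}, 0 < r → dist x₀ y = r →
      IsGeodesicOn (Γ y) r ∧ Γ y 0 = x₀ ∧ Γ y r = y := by
    rintro y r hr rfl
    exact hΓ y (ne_base hr rfl)
  have uniq : ∀ {y : X} {r : ℝ}, 0 < r → dist x₀ y = r → ∀ γ : ℝ → X,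
      IsGeodesicOn γ r → γ 0 = x₀ → γ r = y → ∀ s ∈ Set.Icc 0 r, γ s = Γ y s := by
    rintro y r hr rfl
    exact huniq y (ne_base hr rfl)
  have hmaps : ∀ y : X, dist x₀ y = r₂ → dist x₀ (Γ y r₁) = r₁ := by
    intro y hy
    obtain ⟨hg, h0, -⟩ := geo hr₂0 hy
    simpa only [h0] using hg.dist_zero hr₁.le hr₁₂.le
  refine ⟨hmaps, ?_⟩
  have hsphere : ∀ {r : ℝ} (y : Metric.sphere x₀ r), dist x₀ y = r := fun y => by
    rw [dist_comm]
    exact y.2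
  let F : Metric.sphere x₀ r₂ → Metric.sphere x₀ r₁ := fun y =>
    ⟨Γ y r₁, by
      rw [Metric.mem_sphere, dist_comm]
      exact hmaps y (hsphere y)⟩
  have hgraph : ∀ (y : Metric.sphere x₀ r₂) (z : Metric.sphere x₀ r₁),
      F y = z ↔ dist (z : X) y = r₂ - r₁ := by
    intro y z
    constructor
    · rintro rfl
      obtain ⟨hg, -, hend⟩ := geo hr₂0 (hsphere y)
      have h := hg r₁ ⟨hr₁.le, hr₁₂.le⟩ r₂ ⟨hr₂0.le, le_rfl⟩
      rwa [hend, abs_sub_comm, abs_of_pos (sub_pos.2 hr₁₂)] at h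
    · intro hzy
      obtain ⟨hg, h0, hend⟩ := geo hr₁ (hsphere z)
      obtain ⟨σ, hσ, hσ0, hσend⟩ := hgeo z y
      rw [hzy] at hσ hσend
      have hc := hg.concat_s7 hr₁.le (sub_pos.2 hr₁₂).le hσ (hend.trans hσ0.symm)
        (by rw [h0, hσend, hsphere y, add_sub_cancel])
      rw [add_sub_cancel] at hc
      have h := uniq hr₂0 (hsphere y) _ hc (by simpa only [hr₁.le, if_true] using h0)
        (by simpa only [hr₁₂.not_ge, if_false] using hσend) r₁ ⟨hr₁.le, hr₁₂.le⟩
      simp only [le_refl, if_true] at h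
      exact Subtype.ext (h.symm.trans hend)
  have : CompactSpace (Metric.sphere x₀ r₁) :=
    isCompact_iff_compactSpace.1 Metric.isClosed_sphere.isCompact
  have : CompactSpace (Metric.sphere x₀ r₂) :=
    isCompact_iff_compactSpace.1 Metric.isClosed_sphere.isCompact
  have hcont : Continuous F := by
    refine continuous_iff_isClosed.2 fun C hC => ?_
    have hpre : F ⁻¹' C = Prod.fst ''
        ({p : Metric.sphere x₀ r₂ × Metric.sphere x₀ r₁ | dist (p.2 : X) p.1 = r₂ - r₁} ∩
          Prod.snd ⁻¹' C) := by
      ext y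
      constructor
      · exact fun hy => ⟨(y, F y), ⟨(hgraph y (F y)).1 rfl, hy⟩, rfl⟩
      · rintro ⟨⟨y', z⟩, ⟨hz, hzC⟩, rfl⟩
        rw [Set.mem_preimage, (hgraph y' z).2 hz]
        exact hzC
    rw [hpre]
    exact isClosedMap_fst_of_compactSpace _
      ((isClosed_eq (by fun_prop) continuous_const).inter (hC.preimage continuous_snd))
  have hinj : Function.Injective F := by
    intro y y' hyy'
    obtain ⟨hg, h0, hend⟩ := geo hr₂0 (hsphere y)
    obtain ⟨hg', h0', hend'⟩ := geo hr₂0 (hsphere y')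
    have hinit : ∀ s ∈ Set.Icc 0 r₁, Γ y s = Γ y' s := fun s hs =>
      (uniq hr₁ (hmaps y (hsphere y)) _ (hg.mono hr₁₂.le) h0 rfl s hs).trans
        (uniq hr₁ (hmaps y (hsphere y)) _ (hg'.mono hr₁₂.le) h0'
          (congrArg Subtype.val hyy').symm s hs).symm
    have h := hnb r₂ r₁ hr₁ hr₁₂.le _ _ hg hg' hinit r₂ ⟨hr₂0.le, le_rfl⟩
    exact Subtype.ext (hend.symm.trans (h.trans hend'))
  have hsurj : Function.Surjective F := by
    intro z
    obtain ⟨hg, h0, hend⟩ := geo hr₁ (hsphere z)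
    obtain ⟨γ, hγ, hγeq⟩ := hext r₁ hr₁ (hr₁₂.trans hr₂) _ hg h0
    have hγ0 : γ 0 = x₀ := (hγeq 0 ⟨le_rfl, hr₁.le⟩).trans h0
    have hγr₁ : γ r₁ = z := (hγeq r₁ ⟨hr₁.le, le_rfl⟩).trans hend
    have hy : dist x₀ (γ r₂) = r₂ := by
      simpa only [hγ0] using hγ.dist_zero hr₂0.le hr₂.le
    refine ⟨⟨γ r₂, by rwa [Metric.mem_sphere, dist_comm]⟩, Subtype.ext ?_⟩
    exact (uniq hr₂0 hy γ (hγ.mono hr₂.le) hγ0 rfl r₁ ⟨hr₁.le, hr₁₂.le⟩).symm.trans hγr₁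
  exact ⟨hcont.homeoOfEquivCompactToT2 (f := Equiv.ofBijective F ⟨hinj, hsurj⟩), fun y => rfl⟩
end
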